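/- arXiv:0811.1955 — 3 statements merged into one kernel-verified Lean document; each statement's English description precedes it below -/
import Mathlib

section
/- Let k be a field and α, β ≥ 1 integers. Let A = k[u,v]/(uv) and B = k[x,y]/(xy), and let φ : A → B be the k-algebra homomorphism with φ(u) = x^α and φ(v) = y^β (well defined since x^α y^β = 0 in B). Then: (i) φ is injective, and as an A-module B is the internal direct sum of the cyclic submodules A·1, A·x^l for 1 ≤ l ≤ α−1, and A·y^m for 1 ≤ m ≤ β−1, with A·x^l ≅ A/(v) and A·y^m ≅ A/(u); (ii) consequently there is an isomorphism of A-modules Hom_A(B, A) ≅ A ⊕ (uA)^{⊕(α−1)} ⊕ (vA)^{⊕(β−1)}, where uA and vA are the principal ideals of A generated by u and v. -/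
open MvPolynomial

set_option synthInstance.maxHeartbeats 1000000
set_option maxHeartbeats 1000000

/-- The affine node `B = k[x,y]/(xy)`. -/
abbrev NodeRing (k : Type) [Field k] : Type :=
  MvPolynomial (Fin 2) k ⧸ (Ideal.span {(X 0 * X 1 : MvPolynomial (Fin 2) k)})

/-- The class of `x` in `k[x,y]/(xy)`. -/
noncomputable def nodeX (k : Type) [Field k] : NodeRing k :=
  Ideal.Quotient.mk _ (X 0)

/-- The class of `y` in `k[x,y]/(xy)`. -/
noncomputable def nodeY (k : Type) [Field k] : NodeRing k :=
  Ideal.Quotient.mk _ (X 1)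

/-- A second copy `A = k[u,v]/(uv)` of the affine node (with variables indexed by `Bool`). -/
abbrev NodeRing' (k : Type) [Field k] : Type :=
  MvPolynomial Bool k ⧸ (Ideal.span {(X false * X true : MvPolynomial Bool k)})

/-- The class of `u` in `k[u,v]/(uv)`. -/
noncomputable def nodeU (k : Type) [Field k] : NodeRing' k :=
  Ideal.Quotient.mk _ (X false)

/-- The class of `v` in `k[u,v]/(uv)`. -/
noncomputable def nodeV (k : Type) [Field k] : NodeRing' k :=
  Ideal.Quotient.mk _ (X true)

/-- The family of cyclic `A`-submodules `A·1`, `A·x^l` (`1 ≤ l ≤ α-1`) and `A·y^m`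
(`1 ≤ m ≤ β-1`) of `B = k[x,y]/(xy)`, where `A = k[u,v]/(uv)` acts via `u ↦ x^α`, `v ↦ y^β`. -/
noncomputable def cyclicFam (k : Type) [Field k]
    [Algebra (NodeRing' k) (NodeRing k)] (α β : ℕ) :
    (Unit ⊕ Fin (α - 1) ⊕ Fin (β - 1)) → Submodule (NodeRing' k) (NodeRing k)
  | Sum.inl _ => Submodule.span (NodeRing' k) {(1 : NodeRing k)}
  | Sum.inr (Sum.inl l) => Submodule.span (NodeRing' k) {nodeX k ^ ((l : ℕ) + 1)}
  | Sum.inr (Sum.inr m) => Submodule.span (NodeRing' k) {nodeY k ^ ((m : ℕ) + 1)}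

structure IsNode (k R : Type) [Field k] [CommRing R] [Algebra k R] (u v : R) : Prop where
  mul : u * v = 0
  dec : ∀ a : R, ∃ p q : Polynomial k, a = Polynomial.aeval u p + v * Polynomial.aeval v q
  pU : ∃ f : R →ₐ[k] Polynomial k, f u = Polynomial.X ∧ f v = 0
  pV : ∃ f : R →ₐ[k] Polynomial k, f u = 0 ∧ f v = Polynomial.X

namespace IsNode

section one
variable {k R : Type} [Field k] [CommRing R] [Algebra k R] {u v : R}

theorem symm (h : IsNode k R u v) : IsNode k R v u where
  mul := by rw [mul_comm, h.mul]
  dec a := by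
    obtain ⟨p, q, rfl⟩ := h.dec a
    refine ⟨Polynomial.C (p.coeff 0) + Polynomial.X * q, p.divX, ?_⟩
    conv_lhs => rw [← Polynomial.X_mul_divX_add p]
    simp only [map_add, map_mul, Polynomial.aeval_X, Polynomial.aeval_C]
    ring
  pU := by obtain ⟨f, h1, h2⟩ := h.pV; exact ⟨f, h2, h1⟩
  pV := by obtain ⟨f, h1, h2⟩ := h.pU; exact ⟨f, h2, h1⟩

theorem apply_aeval (f : R →ₐ[k] Polynomial k) (r : R) (p : Polynomial k) :
    f (Polynomial.aeval r p) = Polynomial.aeval (f r) p :=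
  (Polynomial.aeval_algHom_apply f r p).symm

theorem mem_of_pU (h : IsNode k R u v) (f : R →ₐ[k] Polynomial k) (hu : f u = Polynomial.X)
    (hv : f v = 0) {a : R} (ha : f a = 0) : a ∈ Ideal.span {v} := by
  obtain ⟨p, q, rfl⟩ := h.dec a
  have : p = 0 := by simpa [apply_aeval, hu, hv] using ha
  subst this
  rw [map_zero, zero_add]
  exact Ideal.mul_mem_right _ _ (Ideal.subset_span rfl)

theorem mem_of_pV (h : IsNode k R u v) (f : R →ₐ[k] Polynomial k) (hu : f u = 0)
    (hv : f v = Polynomial.X) {a : R} (ha : f a = 0) : a ∈ Ideal.span {u} :=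
  h.symm.mem_of_pU f hv hu ha

theorem inter (h : IsNode k R u v) {a : R} (h1 : a ∈ Ideal.span {u}) (f : R →ₐ[k] Polynomial k)
    (hu : f u = Polynomial.X) (hv : f v = 0) (ha : f a = 0) : a = 0 := by
  obtain ⟨g, gu, gv⟩ := h.pV
  have hg : g a = 0 := by
    obtain ⟨c, rfl⟩ := Ideal.mem_span_singleton'.1 h1
    simp [gu]
  obtain ⟨p, q, rfl⟩ := h.dec a
  have : p = 0 := by simpa [apply_aeval, hu, hv] using ha
  subst this
  have : q = 0 := by simpa [apply_aeval, gu, gv] using hg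
  simp [this]

theorem ann (h : IsNode k R u v) {a : R} (h1 : v * a = 0) : a ∈ Ideal.span {u} := by
  obtain ⟨g, gu, gv⟩ := h.pV
  refine h.mem_of_pV g gu gv ?_
  have := congrArg g h1
  simpa [gv] using this

theorem mul_zero_of_mem (h : IsNode k R u v) {a b : R} (ha : a ∈ Ideal.span {u})
    (hb : b ∈ Ideal.span {v}) : a * b = 0 := by
  obtain ⟨c, rfl⟩ := Ideal.mem_span_singleton'.1 ha
  obtain ⟨d, rfl⟩ := Ideal.mem_span_singleton'.1 hb
  linear_combination c * d * h.mul

theorem hom_ext (h : IsNode k R u v) {S : Type} [CommRing S] [Algebra k S] {f g : R →ₐ[k] S}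
    (hu : f u = g u) (hv : f v = g v) : f = g := by
  ext a
  obtain ⟨p, q, rfl⟩ := h.dec a
  simp only [map_add, map_mul, ← Polynomial.aeval_algHom_apply, hu, hv]

end one

theorem poly_indep {k : Type} [Field k] (α : ℕ) (hα : 1 ≤ α) (p : Polynomial k)
    (b : Fin (α - 1) → Polynomial k)
    (h : Polynomial.expand k α p + ∑ l, Polynomial.expand k α (b l) * Polynomial.X ^ ((l : ℕ) + 1)
      = 0) : p = 0 ∧ ∀ l, b l = 0 := by
  have key : ∀ n r : ℕ, r < α → ∀ l : Fin (α - 1),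
      (Polynomial.expand k α (b l) * Polynomial.X ^ ((l : ℕ) + 1)).coeff (n * α + r) =
      if r = l + 1 then (b l).coeff n else 0 := by
    intro n r hr l
    have hl := l.2
    rw [Polynomial.coeff_mul_X_pow', Polynomial.coeff_expand (by omega)]
    by_cases e : r = l + 1
    · subst e
      simp [show n * α + (l + 1) - (l + 1) = n * α by omega, show 0 < α by omega]
    · rw [if_neg e]
      split_ifs with h1 h2
      · exfalso
        obtain ⟨c, hc⟩ := h2
        have e1 : n * α + r = (l + 1) + α * c := by omega
        have e2 := congrArg (· % α) e1
        simp only [Nat.mul_add_mod_self_right, Nat.add_mul_mod_self_left] at e2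
        rw [Nat.mod_eq_of_lt hr, Nat.mod_eq_of_lt (by omega)] at e2
        exact e e2
      · rfl
      · rfl
  have keyp : ∀ n r : ℕ, r < α → (Polynomial.expand k α p).coeff (n * α + r) =
      if r = 0 then p.coeff n else 0 := by
    intro n r hr
    rw [Polynomial.coeff_expand (by omega)]
    by_cases e : r = 0
    · subst e; simp [show 0 < α by omega]
    · rw [if_neg e, if_neg]
      intro h
      rw [Nat.dvd_add_right (Dvd.intro_left _ rfl)] at h
      exact e (Nat.eq_zero_of_dvd_of_lt h hr)
  have tot : ∀ n r : ℕ, r < α → (if r = 0 then p.coeff n else 0) +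
      ∑ l : Fin (α - 1), (if r = l + 1 then (b l).coeff n else 0) = 0 := by
    intro n r hr
    have := congrArg (fun f => f.coeff (n * α + r)) h
    simp only [Polynomial.coeff_add, Polynomial.finsetSum_coeff, Polynomial.coeff_zero] at this
    rw [keyp n r hr, Finset.sum_congr rfl (fun l _ => key n r hr l)] at this
    exact this
  constructor
  · ext n
    simpa using tot n 0 (by omega)
  · intro l
    ext n
    have := tot n (l + 1) (by omega)
    simpa [Fin.val_inj, Finset.sum_ite_eq] using this

section two
variable {k A B : Type} [Field k] [CommRing A] [CommRing B] [Algebra k A] [Algebra k B]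
  [Algebra A B] [IsScalarTower k A B] {u v : A} {x y : B}

/-- Half of the key independence. -/
theorem half (hA : IsNode k A u v) (hB : IsNode k B x y) (α β : ℕ) (hα : 1 ≤ α) (hβ : 1 ≤ β)
    (hu : algebraMap A B u = x ^ α) (hv : algebraMap A B v = y ^ β)
    (a : A) (b : Fin (α - 1) → A) (c : Fin (β - 1) → A)
    (h : a • (1 : B) + ∑ l, b l • x ^ ((l : ℕ) + 1) + ∑ m, c m • y ^ ((m : ℕ) + 1) = 0) :
    (∃ f : A →ₐ[k] Polynomial k, f u = Polynomial.X ∧ f v = 0 ∧ f a = 0) ∧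
      ∀ l, b l ∈ Ideal.span {v} := by
  obtain ⟨f, fu, fv⟩ := hA.pU
  obtain ⟨g, gx, gy⟩ := hB.pU
  have e : g.comp (IsScalarTower.toAlgHom k A B) = (Polynomial.expand k α).comp f := by
    apply hA.hom_ext
    · simp [hu, gx, fu]
    · simp [hv, gy, fv, show β ≠ 0 by omega]
  have e' : ∀ a, g (algebraMap A B a) = Polynomial.expand k α (f a) := fun a => by
    simpa using DFunLike.congr_fun e a
  have := congrArg g h
  simp only [Algebra.smul_def, map_add, map_sum, map_mul, map_pow, gx, gy, e', map_one, mul_one,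
    map_zero, ne_eq, Nat.succ_ne_zero, not_false_eq_true, zero_pow, mul_zero,
    Finset.sum_const_zero, add_zero] at this
  obtain ⟨h1, h2⟩ := poly_indep α hα _ _ this
  exact ⟨⟨f, fu, fv, h1⟩, fun l => hA.mem_of_pU f fu fv (h2 l)⟩

theorem full (hA : IsNode k A u v) (hB : IsNode k B x y) (α β : ℕ) (hα : 1 ≤ α) (hβ : 1 ≤ β)
    (hu : algebraMap A B u = x ^ α) (hv : algebraMap A B v = y ^ β)
    (a : A) (b : Fin (α - 1) → A) (c : Fin (β - 1) → A)
    (h : a • (1 : B) + ∑ l, b l • x ^ ((l : ℕ) + 1) + ∑ m, c m • y ^ ((m : ℕ) + 1) = 0) :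
    a = 0 ∧ (∀ l, b l ∈ Ideal.span {v}) ∧ ∀ m, c m ∈ Ideal.span {u} := by
  obtain ⟨⟨f, fu, fv, fa⟩, h2⟩ := half hA hB α β hα hβ hu hv a b c h
  obtain ⟨⟨g, gv, gu, ga⟩, h3⟩ := half hA.symm hB.symm β α hβ hα hv hu a c b
    (by rw [← h]; ring)
  exact ⟨hA.inter (hA.mem_of_pV g gu gv ga) f fu fv fa, h2, h3⟩

theorem span_half (α : ℕ) (hα : 1 ≤ α)
    (hu : algebraMap A B u = x ^ α) (S : Submodule A B) (h1 : (1 : B) ∈ S)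
    (hx : ∀ l : Fin (α - 1), x ^ ((l : ℕ) + 1) ∈ S) (p : Polynomial k) :
    Polynomial.aeval x p ∈ S := by
  have hk : ∀ (c : k) (b : B), b ∈ S → c • b ∈ S := fun c b hb => by
    rw [← algebraMap_smul A c b]; exact S.smul_mem _ hb
  have hr : ∀ r < α, x ^ r ∈ S := by
    intro r hr
    rcases r with _ | r
    · simpa using h1
    · exact hx ⟨r, by omega⟩
  rw [Polynomial.aeval_eq_sum_range]
  refine S.sum_mem fun n _ => hk _ _ ?_
  have : x ^ n = (u ^ (n / α)) • x ^ (n % α) := by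
    rw [Algebra.smul_def, map_pow, hu, ← pow_mul, ← pow_add, Nat.div_add_mod]
  rw [this]
  exact S.smul_mem _ (hr _ (Nat.mod_lt _ hα))

theorem span_full (hB : IsNode k B x y) (α β : ℕ) (hα : 1 ≤ α) (hβ : 1 ≤ β)
    (hu : algebraMap A B u = x ^ α) (hv : algebraMap A B v = y ^ β)
    (S : Submodule A B) (h1 : (1 : B) ∈ S)
    (hx : ∀ l : Fin (α - 1), x ^ ((l : ℕ) + 1) ∈ S)
    (hy : ∀ l : Fin (β - 1), y ^ ((l : ℕ) + 1) ∈ S) : S = ⊤ := by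
  rw [eq_top_iff]
  rintro b -
  obtain ⟨p, q, rfl⟩ := hB.dec b
  refine S.add_mem (span_half (k := k) α hα hu S h1 hx p) ?_
  have := span_half (k := k) β hβ hv S h1 hy (Polynomial.X * q)
  simpa using this

/-- abstract isomorphism of the cyclic module generated by a power of `x`. -/
theorem cyc (hA : IsNode k A u v) (hB : IsNode k B x y) (α β : ℕ) (hα : 1 ≤ α) (hβ : 1 ≤ β)
    (hu : algebraMap A B u = x ^ α) (hv : algebraMap A B v = y ^ β) (l : Fin (α - 1)) :
    Nonempty ((Submodule.span A {x ^ ((l : ℕ) + 1)}) ≃ₗ[A] (A ⧸ (Ideal.span {v}))) := by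
  have : Ideal.torsionOf A B (x ^ ((l : ℕ) + 1)) = Ideal.span {v} := by
    ext a
    rw [Ideal.mem_torsionOf_iff]
    constructor
    · intro h
      have := (full hA hB α β hα hβ hu hv 0 (Pi.single l a) 0 (by
        rw [Finset.sum_eq_single l]
        · simp [h]
        · intro m _ hm; simp [hm]
        · simp)).2.1 l
      simpa using this
    · intro h
      obtain ⟨c, rfl⟩ := Ideal.mem_span_singleton'.1 h
      obtain ⟨b, rfl⟩ : ∃ b, b + 1 = β := ⟨β - 1, by omega⟩
      rw [Algebra.smul_def, map_mul, hv]
      linear_combination (algebraMap A B c * y ^ b * x ^ (l : ℕ)) * hB.mul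
  exact ⟨(Ideal.quotTorsionOfEquivSpanSingleton A B _).symm.trans (Submodule.quotEquivOfEq _ _ this)⟩

theorem xpow_smul (hB : IsNode k B x y) (β : ℕ) (hβ : 1 ≤ β)
    (hv : algebraMap A B v = y ^ β) (l : ℕ) {a : A} (ha : a ∈ Ideal.span {v}) :
    a • x ^ (l + 1) = 0 := by
  obtain ⟨c, rfl⟩ := Ideal.mem_span_singleton'.1 ha
  obtain ⟨b, rfl⟩ : ∃ b, b + 1 = β := ⟨β - 1, by omega⟩
  rw [Algebra.smul_def, map_mul, hv]
  linear_combination (algebraMap A B c * y ^ b * x ^ (l : ℕ)) * hB.mul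

theorem inj (hA : IsNode k A u v) (hB : IsNode k B x y) (α β : ℕ) (hα : 1 ≤ α) (hβ : 1 ≤ β)
    (hu : algebraMap A B u = x ^ α) (hv : algebraMap A B v = y ^ β) :
    Function.Injective (algebraMap A B) := by
  rw [injective_iff_map_eq_zero]
  intro a ha
  exact (full hA hB α β hα hβ hu hv a 0 0 (by simp [Algebra.smul_def, ha])).1

theorem indep (hA : IsNode k A u v) (hB : IsNode k B x y) (α β : ℕ) (hα : 1 ≤ α) (hβ : 1 ≤ β)
    (hu : algebraMap A B u = x ^ α) (hv : algebraMap A B v = y ^ β)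
    (F : (Unit ⊕ Fin (α - 1) ⊕ Fin (β - 1)) → Submodule A B)
    (F1 : F (Sum.inl ()) = Submodule.span A {1})
    (F2 : ∀ l, F (Sum.inr (Sum.inl l)) = Submodule.span A {x ^ ((l : ℕ) + 1)})
    (F3 : ∀ l, F (Sum.inr (Sum.inr l)) = Submodule.span A {y ^ ((l : ℕ) + 1)}) :
    iSupIndep F := by
  classical
  apply iSupIndep_of_dfinsupp_lsum_injective
  refine (injective_iff_map_eq_zero _).2 ?_
  intro m hm
  rw [DFinsupp.lsum_apply_apply, DFinsupp.sumAddHom_apply,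
    DFinsupp.sum_eq_sum_fintype _ (by simp)] at hm
  simp only [Fintype.sum_sum_type, Finset.univ_unique, Finset.sum_singleton] at hm
  have e1 := (m (Sum.inl ())).2
  have e2 := fun l => (m (Sum.inr (Sum.inl l))).2
  have e3 := fun l => (m (Sum.inr (Sum.inr l))).2
  simp only [F1, F2, F3, Submodule.mem_span_singleton] at e1 e2 e3
  obtain ⟨a, ha⟩ := e1
  choose b hb using e2
  choose c hc using e3
  obtain ⟨h1, h2, h3⟩ := full hA hB α β hα hβ hu hv a b c (by
    simp only [ha, hb, hc, add_assoc]
    exact hm)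
  ext s
  rcases s with s | l | l
  · rw [show s = () from rfl, ← ha, h1]; simp
  · rw [← hb, xpow_smul hB β hβ hv _ (h2 l)]; simp
  · rw [← hc, xpow_smul hB.symm α hα hu _ (h3 l)]; simp

theorem hom (hA : IsNode k A u v) (hB : IsNode k B x y) (α β : ℕ) (hα : 1 ≤ α) (hβ : 1 ≤ β)
    (hu : algebraMap A B u = x ^ α) (hv : algebraMap A B v = y ^ β) :
    Nonempty ((B →ₗ[A] A) ≃ₗ[A] (A × (Fin (α - 1) → (Ideal.span {u} : Ideal A)) ×
        (Fin (β - 1) → (Ideal.span {v} : Ideal A)))) := by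
  have mx : ∀ (f : B →ₗ[A] A) (l : ℕ), f (x ^ (l + 1)) ∈ Ideal.span {u} := fun f l => by
    apply hA.ann
    rw [← smul_eq_mul, ← map_smul,
      xpow_smul hB β hβ hv _ (Ideal.subset_span rfl), map_zero]
  have my : ∀ (f : B →ₗ[A] A) (l : ℕ), f (y ^ (l + 1)) ∈ Ideal.span {v} := fun f l => by
    apply hA.symm.ann
    rw [← smul_eq_mul, ← map_smul,
      xpow_smul hB.symm α hα hu _ (Ideal.subset_span rfl), map_zero]
  let T : (B →ₗ[A] A) →ₗ[A] (A × (Fin (α - 1) → (Ideal.span {u} : Ideal A)) ×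
        (Fin (β - 1) → (Ideal.span {v} : Ideal A))) :=
    { toFun := fun f => (f 1, fun l => ⟨f (x ^ ((l : ℕ) + 1)), mx f l⟩,
        fun l => ⟨f (y ^ ((l : ℕ) + 1)), my f l⟩)
      map_add' := fun f g => rfl
      map_smul' := fun a f => rfl }
  refine ⟨LinearEquiv.ofBijective T ⟨?_, ?_⟩⟩
  · intro f g hfg
    have h1 : f 1 = g 1 := congrArg (fun t => t.1) hfg
    have h2 : ∀ l : Fin (α - 1), f (x ^ ((l : ℕ) + 1)) = g (x ^ ((l : ℕ) + 1)) := fun l =>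
      congrArg (fun t => ((t.2.1 l : (Ideal.span {u} : Ideal A)) : A)) hfg
    have h3 : ∀ l : Fin (β - 1), f (y ^ ((l : ℕ) + 1)) = g (y ^ ((l : ℕ) + 1)) := fun l =>
      congrArg (fun t => ((t.2.2 l : (Ideal.span {v} : Ideal A)) : A)) hfg
    have := span_full hB α β hα hβ hu hv (LinearMap.eqLocus f g) h1 h2 h3
    exact LinearMap.eqLocus_eq_top.1 this
  · rintro ⟨a, b, c⟩
    let mk : ∀ (M : Type) [AddCommGroup M] [Module A M], M → (Fin (α - 1) → M) →
        (Fin (β - 1) → M) → ((A × (Fin (α - 1) → A) × (Fin (β - 1) → A)) →ₗ[A] M) :=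
      fun M _ _ p q r => LinearMap.coprod (LinearMap.toSpanSingleton A M p)
        (LinearMap.coprod (Fintype.linearCombination A q) (Fintype.linearCombination A r))
    let Ψ := mk B 1 (fun l => x ^ ((l : ℕ) + 1)) (fun l => y ^ ((l : ℕ) + 1))
    let G := mk A a (fun l => b l) (fun l => c l)
    have hmk : ∀ (M : Type) [AddCommGroup M] [Module A M] (p : M) (q : Fin (α - 1) → M)
        (r : Fin (β - 1) → M) t, mk M p q r t =
          t.1 • p + ∑ l, t.2.1 l • q l + ∑ l, t.2.2 l • r l := by
      intro M _ _ p q r t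
      simp [mk, Fintype.linearCombination_apply, add_assoc]
    have mk1 : ∀ (M : Type) [AddCommGroup M] [Module A M] (p : M) (q : Fin (α - 1) → M)
        (r : Fin (β - 1) → M), mk M p q r (1, 0, 0) = p := by
      intro M _ _ p q r
      simp [hmk]
    have mk2 : ∀ (M : Type) [AddCommGroup M] [Module A M] (p : M) (q : Fin (α - 1) → M)
        (r : Fin (β - 1) → M) l, mk M p q r (0, Pi.single l 1, 0) = q l := by
      intro M _ _ p q r l
      simp [mk]
    have mk3 : ∀ (M : Type) [AddCommGroup M] [Module A M] (p : M) (q : Fin (α - 1) → M)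
        (r : Fin (β - 1) → M) l, mk M p q r (0, 0, Pi.single l 1) = r l := by
      intro M _ _ p q r l
      simp [mk]
    have hΨ : LinearMap.range Ψ = ⊤ := span_full hB α β hα hβ hu hv _
      ⟨_, mk1 _ _ _ _⟩ (fun l => ⟨_, mk2 _ _ _ _ l⟩) (fun l => ⟨_, mk3 _ _ _ _ l⟩)
    have hker : LinearMap.ker Ψ ≤ LinearMap.ker G := by
      intro t ht
      rw [LinearMap.mem_ker] at ht ⊢
      have ht' := (hmk _ _ _ _ _).symm.trans ht
      obtain ⟨h1, h2, h3⟩ := full hA hB α β hα hβ hu hv _ _ _ ht'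
      refine (hmk _ _ _ _ _).trans ?_
      rw [h1, zero_smul, zero_add, Finset.sum_eq_zero, Finset.sum_eq_zero, add_zero]
      · intro l _
        exact hA.mul_zero_of_mem (h3 l) (c l).2
      · intro l _
        exact hA.symm.mul_zero_of_mem (h2 l) (b l).2
    let f : B →ₗ[A] A := ((LinearMap.ker Ψ).liftQ G hker).comp
      (Ψ.quotKerEquivOfSurjective (LinearMap.range_eq_top.1 hΨ)).symm.toLinearMap
    have hf : ∀ t, f (Ψ t) = G t := by
      intro t
      have : (Ψ.quotKerEquivOfSurjective (LinearMap.range_eq_top.1 hΨ)).symm (Ψ t)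
          = Submodule.Quotient.mk t := by
        rw [LinearEquiv.symm_apply_eq]; rfl
      change ((LinearMap.ker Ψ).liftQ G hker)
        ((Ψ.quotKerEquivOfSurjective (LinearMap.range_eq_top.1 hΨ)).symm (Ψ t)) = _
      rw [this]; rfl
    refine ⟨f, ?_⟩
    have f1 : f 1 = a := by
      have := hf (1, 0, 0)
      rwa [mk1, mk1] at this
    have f2 : ∀ l : Fin (α - 1), f (x ^ ((l : ℕ) + 1)) = b l := fun l => by
      have := hf (0, Pi.single l 1, 0)
      rwa [mk2, mk2] at this
    have f3 : ∀ l : Fin (β - 1), f (y ^ ((l : ℕ) + 1)) = c l := fun l => by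
      have := hf (0, 0, Pi.single l 1)
      rwa [mk3, mk3] at this
    exact Prod.ext f1 (Prod.ext (funext fun l => Subtype.ext (f2 l))
      (funext fun l => Subtype.ext (f3 l)))

end two

/-- The quotient of a polynomial ring in two variables `i, j` is a node. -/
theorem of_quot (k σ : Type) [Field k] [DecidableEq σ] (i j : σ) (hij : i ≠ j)
    (hs : ∀ s, s = i ∨ s = j) :
    IsNode k (MvPolynomial σ k ⧸ (Ideal.span {(X i * X j : MvPolynomial σ k)}))
      (Ideal.Quotient.mk _ (X i)) (Ideal.Quotient.mk _ (X j)) := by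
  have hm : (Ideal.Quotient.mk (Ideal.span {(X i * X j : MvPolynomial σ k)}) (X i)) *
      (Ideal.Quotient.mk _ (X j)) = 0 := by
    rw [← map_mul]
    exact Ideal.Quotient.eq_zero_iff_mem.2 (Ideal.subset_span rfl)
  have pr : ∀ w : σ → Polynomial k, w i * w j = 0 →
      ∃ f : (MvPolynomial σ k ⧸ (Ideal.span {(X i * X j : MvPolynomial σ k)})) →ₐ[k] Polynomial k,
        f (Ideal.Quotient.mk _ (X i)) = w i ∧ f (Ideal.Quotient.mk _ (X j)) = w j := by
    intro w hw
    refine ⟨Ideal.Quotient.liftₐ _ (MvPolynomial.aeval w) ?_, ?_, ?_⟩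
    · intro a ha
      obtain ⟨c, rfl⟩ := Ideal.mem_span_singleton'.1 ha
      simp [hw]
    · exact MvPolynomial.aeval_X w i
    · exact MvPolynomial.aeval_X w j
  refine ⟨hm, ?_, ?_, ?_⟩
  · intro a
    obtain ⟨a, rfl⟩ := Ideal.Quotient.mk_surjective a
    generalize hU : (Ideal.Quotient.mk (Ideal.span {(X i * X j : MvPolynomial σ k)}) (X i)) = U at *
    generalize hV : (Ideal.Quotient.mk (Ideal.span {(X i * X j : MvPolynomial σ k)}) (X j)) = V at *
    induction a using MvPolynomial.induction_on with
    | C c => exact ⟨Polynomial.C c, 0, by rw [Polynomial.aeval_C, map_zero, mul_zero, add_zero]; rfl⟩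
    | add a b ha hb =>
      obtain ⟨p, q, h⟩ := ha
      obtain ⟨p', q', h'⟩ := hb
      refine ⟨p + p', q + q', ?_⟩
      rw [map_add, h, h', map_add, map_add]; ring
    | mul_X a s ha =>
      obtain ⟨p, q, h⟩ := ha
      rw [map_mul, h]
      rcases hs s with rfl | rfl
      · refine ⟨p * Polynomial.X, 0, ?_⟩
        rw [hU, map_mul, Polynomial.aeval_X, map_zero]
        linear_combination Polynomial.aeval V q * hm
      · refine ⟨0, Polynomial.C (p.coeff 0) + Polynomial.X * q, ?_⟩
        conv_lhs => rw [← Polynomial.X_mul_divX_add p]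
        rw [hV]
        simp only [map_add, map_mul, Polynomial.aeval_X, Polynomial.aeval_C, map_zero]
        linear_combination Polynomial.aeval U p.divX * hm
  · obtain ⟨f, h1, h2⟩ := pr (fun s => if s = i then Polynomial.X else 0) (by simp [hij.symm])
    exact ⟨f, by simpa using h1, by simpa [hij.symm] using h2⟩
  · obtain ⟨f, h1, h2⟩ := pr (fun s => if s = j then Polynomial.X else 0) (by simp [hij])
    exact ⟨f, by simpa [hij] using h1, by simpa using h2⟩

end IsNode

/-- Let `k` be a field and `α, β ≥ 1`.  Let `A = k[u,v]/(uv)`,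
`B = k[x,y]/(xy)`, and `φ : A → B` the `k`-algebra homomorphism with `φ u = x^α`, `φ v = y^β`
(encoded by an algebra structure `Algebra A B` compatible with `k`).  Then:
(i) `φ` is injective, and as an `A`-module `B` is the internal direct sum of the cyclic
submodules `A·1`, `A·x^l` for `1 ≤ l ≤ α-1` and `A·y^m` for `1 ≤ m ≤ β-1`, with
`A·x^l ≅ A/(v)` and `A·y^m ≅ A/(u)`;
(ii) consequently `Hom_A(B, A) ≅ A ⊕ (uA)^{α-1} ⊕ (vA)^{β-1}` as `A`-modules. -/
theorem stmt6 (k : Type) [Field k] (α β : ℕ) (hα : 1 ≤ α) (hβ : 1 ≤ β)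
    [Algebra (NodeRing' k) (NodeRing k)] [IsScalarTower k (NodeRing' k) (NodeRing k)]
    (hu : algebraMap (NodeRing' k) (NodeRing k) (nodeU k) = nodeX k ^ α)
    (hv : algebraMap (NodeRing' k) (NodeRing k) (nodeV k) = nodeY k ^ β) :
    -- (i) injectivity
    Function.Injective (algebraMap (NodeRing' k) (NodeRing k)) ∧
    -- (i) internal direct sum decomposition
    iSupIndep (cyclicFam k α β) ∧ (⨆ s, cyclicFam k α β s) = ⊤ ∧
    -- (i) `A·x^l ≅ A/(v)` and `A·y^m ≅ A/(u)`
    (∀ l : Fin (α - 1), Nonempty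
      ((Submodule.span (NodeRing' k) {nodeX k ^ ((l : ℕ) + 1)}) ≃ₗ[NodeRing' k]
        (NodeRing' k ⧸ (Ideal.span {nodeV k})))) ∧
    (∀ m : Fin (β - 1), Nonempty
      ((Submodule.span (NodeRing' k) {nodeY k ^ ((m : ℕ) + 1)}) ≃ₗ[NodeRing' k]
        (NodeRing' k ⧸ (Ideal.span {nodeU k})))) ∧
    -- (ii) `Hom_A(B, A) ≅ A ⊕ (uA)^{α-1} ⊕ (vA)^{β-1}`
    Nonempty ((NodeRing k →ₗ[NodeRing' k] NodeRing' k) ≃ₗ[NodeRing' k]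
      (NodeRing' k ×
        (Fin (α - 1) → (Ideal.span {nodeU k} : Ideal (NodeRing' k))) ×
        (Fin (β - 1) → (Ideal.span {nodeV k} : Ideal (NodeRing' k))))) := by
  have hA : IsNode k (NodeRing' k) (nodeU k) (nodeV k) :=
    IsNode.of_quot k Bool false true (by simp) (by simp)
  have hB : IsNode k (NodeRing k) (nodeX k) (nodeY k) :=
    IsNode.of_quot k (Fin 2) 0 1 (by simp) (by
      intro s
      fin_cases s <;> simp)
  refine ⟨hA.inj hB α β hα hβ hu hv, hA.indep hB α β hα hβ hu hv _ rfl (fun _ => rfl) (fun _ => rfl),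
    ?_, hA.cyc hB α β hα hβ hu hv, hA.symm.cyc hB.symm β α hβ hα hv hu,
    hA.hom hB α β hα hβ hu hv⟩
  refine hB.span_full α β hα hβ hu hv _ ?_ (fun l => ?_) (fun l => ?_)
  · exact Submodule.mem_iSup_of_mem (Sum.inl ()) (Submodule.mem_span_singleton_self _)
  · exact Submodule.mem_iSup_of_mem (Sum.inr (Sum.inl l)) (Submodule.mem_span_singleton_self _)
  · exact Submodule.mem_iSup_of_mem (Sum.inr (Sum.inr l)) (Submodule.mem_span_singleton_self _)
end

section
/- Let k be a field with char k ≠ 2. Let A = k[t,x]/(t³ − x² + 1) and B = k[t,u]/(u² − t² − t⁵). Then the k-algebra homomorphism ψ : B → A determined by ψ(t) = t and ψ(u) = xt is well defined and injective, and its image equals the subring {f ∈ A : ev_{(0,1)}(f) = ev_{(0,−1)}(f)}, where ev_{(0,±1)} : A → k are the k-algebra evaluation homomorphisms sending t ↦ 0 and x ↦ ±1. -/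
open MvPolynomial

set_option synthInstance.maxHeartbeats 1000000
set_option maxHeartbeats 1000000

/-- The smooth affine curve `A = k[t,x]/(t³ - x² + 1)` (`t = X 0`, `x = X 1`). -/
abbrev CurveA (k : Type) [Field k] : Type :=
  MvPolynomial (Fin 2) k ⧸
    (Ideal.span {(X 0 ^ 3 - X 1 ^ 2 + 1 : MvPolynomial (Fin 2) k)})

/-- The class of `t` in `k[t,x]/(t³ - x² + 1)`. -/
noncomputable def curveAT (k : Type) [Field k] : CurveA k :=
  Ideal.Quotient.mk _ (X 0)

/-- The class of `x` in `k[t,x]/(t³ - x² + 1)`. -/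
noncomputable def curveAX (k : Type) [Field k] : CurveA k :=
  Ideal.Quotient.mk _ (X 1)

/-- The nodal curve `B = k[t,u]/(u² - t² - t⁵)` (`t = X 0`, `u = X 1`). -/
abbrev CurveB (k : Type) [Field k] : Type :=
  MvPolynomial (Fin 2) k ⧸
    (Ideal.span {(X 1 ^ 2 - X 0 ^ 2 - X 0 ^ 5 : MvPolynomial (Fin 2) k)})

/-- The class of `t` in `k[t,u]/(u² - t² - t⁵)`. -/
noncomputable def curveBT (k : Type) [Field k] : CurveB k :=
  Ideal.Quotient.mk _ (X 0)

/-- The class of `u` in `k[t,u]/(u² - t² - t⁵)`. -/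
noncomputable def curveBU (k : Type) [Field k] : CurveB k :=
  Ideal.Quotient.mk _ (X 1)

theorem normal_form_aux {k R : Type} [Field k] [CommRing R] [Algebra k R] (t x : R)
    (c : Polynomial k) (hx : x ^ 2 = Polynomial.aeval t c) (P : MvPolynomial (Fin 2) k) :
    ∃ p q : Polynomial k, MvPolynomial.aeval ![t, x] P =
      Polynomial.aeval t p + Polynomial.aeval t q * x := by
  induction P using MvPolynomial.induction_on with
  | C a => exact ⟨Polynomial.C a, 0, by simp⟩
  | add P Q hP hQ =>
    obtain ⟨p, q, h⟩ := hP
    obtain ⟨p', q', h'⟩ := hQ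
    exact ⟨p + p', q + q', by rw [map_add, h, h', map_add, map_add]; ring⟩
  | mul_X P i hP =>
    obtain ⟨p, q, h⟩ := hP
    fin_cases i
    · refine ⟨p * Polynomial.X, q * Polynomial.X, ?_⟩
      rw [map_mul, h]
      simp
      ring
    · refine ⟨q * c, p, ?_⟩
      rw [map_mul, h, map_mul, ← hx]
      simp
      ring

theorem mk_eq_aeval {k : Type} [Field k] (I : Ideal (MvPolynomial (Fin 2) k))
    (P : MvPolynomial (Fin 2) k) :
    Ideal.Quotient.mk I P = MvPolynomial.aeval
      ![Ideal.Quotient.mk I (X 0), Ideal.Quotient.mk I (X 1)] P := by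
  have : Ideal.Quotient.mkₐ k I = MvPolynomial.aeval
      ![Ideal.Quotient.mk I (X 0), Ideal.Quotient.mk I (X 1)] := by
    apply MvPolynomial.algHom_ext
    intro i
    fin_cases i <;> simp
  exact DFunLike.congr_fun this P

theorem curveA_rel (k : Type) [Field k] :
    curveAX k ^ 2 = curveAT k ^ 3 + 1 := by
  have : (Ideal.Quotient.mk _ (X 0 ^ 3 - X 1 ^ 2 + 1 : MvPolynomial (Fin 2) k) : CurveA k) = 0 :=
    Ideal.Quotient.eq_zero_iff_mem.2 (Ideal.subset_span rfl)
  have h : curveAT k ^ 3 - curveAX k ^ 2 + 1 = 0 := by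
    simp only [map_add, map_sub, map_pow, map_one] at this
    exact this
  linear_combination -h

theorem curveB_rel (k : Type) [Field k] :
    curveBU k ^ 2 = curveBT k ^ 2 + curveBT k ^ 5 := by
  have : (Ideal.Quotient.mk _ (X 1 ^ 2 - X 0 ^ 2 - X 0 ^ 5 : MvPolynomial (Fin 2) k) :
      CurveB k) = 0 :=
    Ideal.Quotient.eq_zero_iff_mem.2 (Ideal.subset_span rfl)
  have h : curveBU k ^ 2 - curveBT k ^ 2 - curveBT k ^ 5 = 0 := by
    simp only [map_add, map_sub, map_pow, map_one] at this
    exact this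
  linear_combination h

theorem curveA_nf (k : Type) [Field k] (f : CurveA k) :
    ∃ p q : Polynomial k, f =
      Polynomial.aeval (curveAT k) p + Polynomial.aeval (curveAT k) q * curveAX k := by
  obtain ⟨P, rfl⟩ := Ideal.Quotient.mk_surjective f
  rw [mk_eq_aeval]
  exact normal_form_aux (curveAT k) (curveAX k) (Polynomial.X ^ 3 + 1)
    (by rw [curveA_rel]; simp) P

theorem curveB_nf (k : Type) [Field k] (f : CurveB k) :
    ∃ p q : Polynomial k, f =
      Polynomial.aeval (curveBT k) p + Polynomial.aeval (curveBT k) q * curveBU k := by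
  obtain ⟨P, rfl⟩ := Ideal.Quotient.mk_surjective f
  rw [mk_eq_aeval]
  exact normal_form_aux (curveBT k) (curveBU k) (Polynomial.X ^ 2 + Polynomial.X ^ 5)
    (by rw [curveB_rel]; simp) P

theorem curveA_indep (k : Type) [Field k] (p q : Polynomial k)
    (h : Polynomial.aeval (curveAT k) p + Polynomial.aeval (curveAT k) q * curveAX k = 0) :
    p = 0 ∧ q = 0 := by
  have e : ∀ r : Polynomial k, Polynomial.aeval (curveAT k) r =
      Ideal.Quotient.mk _ (Polynomial.aeval (X 0 : MvPolynomial (Fin 2) k) r) := fun r =>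
    Polynomial.aeval_algHom_apply (Ideal.Quotient.mkₐ k
      (Ideal.span {(X 0 ^ 3 - X 1 ^ 2 + 1 : MvPolynomial (Fin 2) k)})) (X 0) r
  rw [e, e, curveAX, ← map_mul, ← map_add, Ideal.Quotient.eq_zero_iff_mem,
    Ideal.mem_span_singleton] at h
  let F : MvPolynomial (Fin 2) k →ₐ[k] Polynomial (Polynomial k) :=
    MvPolynomial.aeval ![Polynomial.C Polynomial.X, Polynomial.X]
  have F0 : F (X 0) = Polynomial.C Polynomial.X := by simp [F]
  have F1 : F (X 1) = Polynomial.X := by simp [F]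
  have eF : ∀ r : Polynomial k, F (Polynomial.aeval (X 0) r) = Polynomial.C r := by
    intro r
    rw [← Polynomial.aeval_algHom_apply, F0]
    have := Polynomial.aeval_algHom_apply
      (Polynomial.CAlgHom (R := k) (A := Polynomial k)) Polynomial.X r
    simpa using this
  have h' := map_dvd F h
  simp only [map_add, map_sub, map_mul, map_pow, map_one, eF, F0, F1] at h'
  have hm : (Polynomial.X ^ 2 - Polynomial.C (Polynomial.X ^ 3 + 1) :
      Polynomial (Polynomial k)).Monic := Polynomial.monic_X_pow_sub_C _ (by norm_num)
  have hd : (Polynomial.X ^ 2 - Polynomial.C (Polynomial.X ^ 3 + 1) :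
      Polynomial (Polynomial k)) ∣ Polynomial.C q * Polynomial.X + Polynomial.C p := by
    rw [← neg_dvd]
    convert h' using 1
    · simp only [map_add, map_pow, map_one]; ring
    · ring
  have hz : Polynomial.C q * Polynomial.X + Polynomial.C p = 0 := by
    by_contra hne
    refine hm.not_dvd_of_degree_lt hne ?_ hd
    rw [Polynomial.degree_X_pow_sub_C (by norm_num)]
    exact lt_of_le_of_lt Polynomial.degree_linear_le (by norm_num)
  constructor
  · simpa using congrArg (fun r => Polynomial.coeff r 0) hz
  · simpa using congrArg (fun r => Polynomial.coeff r 1) hz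

/-- Let `k` be a field with `char k ≠ 2`, `A = k[t,x]/(t³ - x² + 1)` and
`B = k[t,u]/(u² - t² - t⁵)`.  Then the `k`-algebra homomorphism `ψ : B → A` determined by
`ψ t = t`, `ψ u = x t` is well defined (i.e. exists) and injective, and its image equals the
subring `{f ∈ A | ev_(0,1) f = ev_(0,-1) f}`, where `ev_(0,±1) : A → k` are the `k`-algebra
evaluation homomorphisms sending `t ↦ 0` and `x ↦ ±1`. -/
theorem stmt8 (k : Type) [Field k] (h2 : (2 : k) ≠ 0)
    (ev₁ ev₂ : CurveA k →ₐ[k] k)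
    (h₁t : ev₁ (curveAT k) = 0) (h₁x : ev₁ (curveAX k) = 1)
    (h₂t : ev₂ (curveAT k) = 0) (h₂x : ev₂ (curveAX k) = -1) :
    ∃ ψ : CurveB k →ₐ[k] CurveA k,
      ψ (curveBT k) = curveAT k ∧
      ψ (curveBU k) = curveAX k * curveAT k ∧
      Function.Injective ψ ∧
      Set.range ψ = {f : CurveA k | ev₁ f = ev₂ f} := by
  let ψ : CurveB k →ₐ[k] CurveA k := Ideal.Quotient.liftₐ _
    (MvPolynomial.aeval ![curveAT k, curveAX k * curveAT k]) (by
      intro a ha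
      rw [Ideal.mem_span_singleton] at ha
      obtain ⟨b, rfl⟩ := ha
      have : MvPolynomial.aeval ![curveAT k, curveAX k * curveAT k]
          (X 1 ^ 2 - X 0 ^ 2 - X 0 ^ 5 : MvPolynomial (Fin 2) k) = 0 := by
        simp only [map_sub, map_pow, MvPolynomial.aeval_X, Matrix.cons_val_zero,
          Matrix.cons_val_one]
        linear_combination (curveAT k) ^ 2 * curveA_rel k
      rw [map_mul, this, zero_mul])
  have ht : ψ (curveBT k) = curveAT k := by
    change MvPolynomial.aeval ![curveAT k, curveAX k * curveAT k] (X 0) = _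
    simp
  have hu : ψ (curveBU k) = curveAX k * curveAT k := by
    change MvPolynomial.aeval ![curveAT k, curveAX k * curveAT k] (X 1) = _
    simp
  have hψ : ∀ p q : Polynomial k,
      ψ (Polynomial.aeval (curveBT k) p + Polynomial.aeval (curveBT k) q * curveBU k) =
      Polynomial.aeval (curveAT k) p +
        Polynomial.aeval (curveAT k) (q * Polynomial.X) * curveAX k := by
    intro p q
    rw [map_add, map_mul, ← Polynomial.aeval_algHom_apply, ← Polynomial.aeval_algHom_apply,
      ht, hu, map_mul, Polynomial.aeval_X]
    ring
  have hev : ∀ (ev : CurveA k →ₐ[k] k), ev (curveAT k) = 0 → ∀ p q : Polynomial k,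
      ev (Polynomial.aeval (curveAT k) p + Polynomial.aeval (curveAT k) q * curveAX k) =
      p.coeff 0 + q.coeff 0 * ev (curveAX k) := by
    intro ev h p q
    rw [map_add, map_mul, ← Polynomial.aeval_algHom_apply, ← Polynomial.aeval_algHom_apply, h]
    simp [Polynomial.coeff_zero_eq_aeval_zero]
  refine ⟨ψ, ht, hu, ?_, ?_⟩
  · rw [injective_iff_map_eq_zero]
    intro f hf
    obtain ⟨p, q, rfl⟩ := curveB_nf k f
    rw [hψ] at hf
    obtain ⟨hp, hq⟩ := curveA_indep k _ _ hf
    have hq' : q = 0 := by simpa using hq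
    simp [hp, hq']
  · ext f
    simp only [Set.mem_range, Set.mem_ofPred_eq]
    constructor
    · rintro ⟨g, rfl⟩
      obtain ⟨p, q, rfl⟩ := curveB_nf k g
      rw [hψ, hev _ h₁t, hev _ h₂t]
      simp
    · intro h
      obtain ⟨p, q, rfl⟩ := curveA_nf k f
      rw [hev _ h₁t, hev _ h₂t, h₁x, h₂x] at h
      have h0 : q.coeff 0 = 0 := by
        have : 2 * q.coeff 0 = 0 := by linear_combination h
        exact (mul_eq_zero.1 this).resolve_left h2
      obtain ⟨r, rfl⟩ := Polynomial.X_dvd_iff.2 h0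
      exact ⟨_, by rw [hψ p r, mul_comm r]⟩
end

section
/- Let k be a field, S = k[u,v,t], and I ⊆ S the ideal generated by uv − t², ut − v², and vt − u². Let Mᵀ : S³ → S² be the map (r₁, r₂, r₃) ↦ (t r₁ + v r₂ + u r₃, u r₁ + t r₂ + v r₃). Then Ext^p_S(S/I, S) = 0 for p ≠ 2, and Ext²_S(S/I, S) is isomorphic as an S-module to the cokernel of Mᵀ, i.e., to S² modulo the submodule generated by (t, u), (v, t), and (u, v). Moreover this module is nonzero and cannot be generated by a single element as an S-module. -/
open MvPolynomial CategoryTheory Opposite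

set_option synthInstance.maxHeartbeats 1000000
set_option maxHeartbeats 1000000

/-- The polynomial ring `S = k[u,v,t]` (`u = X 0`, `v = X 1`, `t = X 2`). -/
abbrev PolyS (k : Type) [Field k] : Type := MvPolynomial (Fin 3) k

/-- The ideal `I = (uv - t², ut - v², vt - u²)` of the triple point. -/
noncomputable def triplePointIdeal (k : Type) [Field k] : Ideal (PolyS k) :=
  Ideal.span {X 0 * X 1 - X 2 ^ 2, X 0 * X 2 - X 1 ^ 2, X 1 * X 2 - X 0 ^ 2}


section resolution
variable {R : Type} [CommRing R]

/-- the terms of the three-term complex -/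
def resX (R : Type) [CommRing R] : ℕ → ModuleCat R
  | 0 => ModuleCat.of R R
  | 1 => ModuleCat.of R (Fin 3 → R)
  | 2 => ModuleCat.of R (Fin 2 → R)
  | _ + 3 => ModuleCat.of R PUnit

/-- the differentials of the three-term complex -/
def resD (d1 : (Fin 3 → R) →ₗ[R] R) (d2 : (Fin 2 → R) →ₗ[R] (Fin 3 → R)) :
    ∀ n : ℕ, resX R (n + 1) ⟶ resX R n
  | 0 => ModuleCat.ofHom d1
  | 1 => ModuleCat.ofHom d2
  | _ + 2 => 0

/-- the three-term complex -/
noncomputable def resC (d1 : (Fin 3 → R) →ₗ[R] R) (d2 : (Fin 2 → R) →ₗ[R] (Fin 3 → R))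
    (h : d1.comp d2 = 0) : ChainComplex (ModuleCat R) ℕ :=
  ChainComplex.of (resX R) (resD d1 d2) (by
    rintro (_ | n)
    · change ModuleCat.ofHom d2 ≫ ModuleCat.ofHom d1 = 0
      rw [← ModuleCat.ofHom_comp, h]; rfl
    · exact Limits.zero_comp)

variable (d1 : (Fin 3 → R) →ₗ[R] R) (d2 : (Fin 2 → R) →ₗ[R] (Fin 3 → R))

theorem resC_d (h : d1.comp d2 = 0) (n : ℕ) : (resC d1 d2 h).d (n + 1) n = resD d1 d2 n := ChainComplex.of_d _ _ _

theorem resX_proj (n : ℕ) : Projective (resX R n) := by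
  match n with
  | 0 => exact ModuleCat.projective_of_free (Module.Free.chooseBasis R R)
  | 1 => exact ModuleCat.projective_of_free (Pi.basisFun R (Fin 3))
  | 2 => exact ModuleCat.projective_of_free (Pi.basisFun R (Fin 2))
  | n + 3 => exact ModuleCat.projective_of_free (M := ModuleCat.of R PUnit) (Module.Basis.empty (ι := Empty) PUnit)

/-- the resolution -/
noncomputable def theRes (h : d1.comp d2 = 0) (I : Ideal R) (hI : LinearMap.range d1 = I)
    (h1 : LinearMap.range d2 = LinearMap.ker d1) (h2 : Function.Injective d2) :
    ProjectiveResolution (ModuleCat.of R (R ⧸ I)) where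
  complex := resC d1 d2 h
  projective n := resX_proj n
  π := (ChainComplex.toSingle₀Equiv _ _).symm ⟨ModuleCat.ofHom (Submodule.mkQ I), by
    rw [resC_d]
    change ModuleCat.ofHom d1 ≫ ModuleCat.ofHom (Submodule.mkQ I) = 0
    rw [← ModuleCat.ofHom_comp]
    have : (Submodule.mkQ I).comp d1 = 0 := by
      rw [← LinearMap.range_le_ker_iff, hI, Submodule.ker_mkQ]
    rw [this]; rfl⟩
  quasiIso := ⟨fun n => by
    match n with
    | 0 =>
      rw [ChainComplex.quasiIsoAt₀_iff, ShortComplex.quasiIso_iff_of_zeros' _ _ rfl rfl]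
      · constructor
        · rw [ShortComplex.moduleCat_exact_iff]
          intro x hx
          have key : ∀ x : R, Submodule.mkQ I x = 0 → ∃ y, d1 y = x := by
            intro x hx
            rw [← LinearMap.mem_ker, Submodule.ker_mkQ, ← hI] at hx
            exact hx
          obtain ⟨y, hy⟩ := key x hx
          refine ⟨y, ?_⟩
          change (resC d1 d2 h).d 1 0 y = x
          rw [resC_d]
          exact hy
        · rw [ModuleCat.epi_iff_surjective]
          exact Submodule.mkQ_surjective I
      · exact (resC d1 d2 h).shape _ _ (by simp)
    | m + 1 =>
      rw [quasiIsoAt_iff_exactAt' (hL := ChainComplex.exactAt_succ_single_obj ..),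
          HomologicalComplex.exactAt_iff' _ (m + 2) (m + 1) m (by simp) (by simp)]
      rw [ShortComplex.moduleCat_exact_iff]
      intro x hx
      change (resC d1 d2 h).d (m + 1) m x = 0 at hx
      change ∃ y, (resC d1 d2 h).d (m + 1 + 1) (m + 1) y = x
      rw [resC_d] at hx
      rw [resC_d]
      match m with
      | 0 =>
        have : x ∈ LinearMap.ker d1 := hx
        rw [← h1] at this
        exact this
      | 1 =>
        refine ⟨0, ?_⟩
        change (0 : Fin 2 → R) = x
        exact (h2 ((map_zero d2).trans hx.symm))
      | m + 2 => exact ⟨0, rfl⟩⟩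

/-- Ext through the resolution. -/
theorem ext_subsing (h : d1.comp d2 = 0) (I : Ideal R) (hI : LinearMap.range d1 = I)
    (h1 : LinearMap.range d2 = LinearMap.ker d1) (h2 : Function.Injective d2)
    (e0 : ∀ f : R →ₗ[R] R, f.comp d1 = 0 → f = 0)
    (e1 : ∀ f : (Fin 3 → R) →ₗ[R] R, f.comp d2 = 0 → ∃ g : R →ₗ[R] R, g.comp d1 = f)
    (p : ℕ) (hp : p ≠ 2) :
    Subsingleton (((Ext R (ModuleCat R) p).obj
      (op (ModuleCat.of R (R ⧸ I)))).obj (ModuleCat.of R R)) := by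
  have e := (theRes d1 d2 h I hI h1 h2).isoExt (R := R) p (ModuleCat.of R R)
  refine ModuleCat.subsingleton_of_isZero (Limits.IsZero.of_iso ?_ e)
  rw [← HomologicalComplex.exactAt_iff_isZero_homology]
  change HomologicalComplex.ExactAt ((resC d1 d2 h).linearYonedaObj R (ModuleCat.of R R)) p
  match p with
  | 0 =>
    rw [HomologicalComplex.exactAt_iff' _ 0 0 1 (by simp) (by simp)]
    rw [ShortComplex.moduleCat_exact_iff]
    intro x hx
    refine ⟨0, ?_⟩
    rw [map_zero]
    change (resC d1 d2 h).d 1 0 ≫ (x : ModuleCat.of R R ⟶ ModuleCat.of R R) = 0 at hx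
    rw [resC_d] at hx
    have := e0 x.hom (congrArg ModuleCat.Hom.hom hx)
    exact (ModuleCat.hom_ext this).symm
  | 1 =>
    rw [HomologicalComplex.exactAt_iff' _ 0 1 2 (by simp) (by simp)]
    rw [ShortComplex.moduleCat_exact_iff]
    intro x hx
    change (resC d1 d2 h).d 2 1 ≫ (x : ModuleCat.of R (Fin 3 → R) ⟶ ModuleCat.of R R) = 0 at hx
    rw [resC_d] at hx
    obtain ⟨g, hg⟩ := e1 x.hom (congrArg ModuleCat.Hom.hom hx)
    refine ⟨ModuleCat.ofHom g, ?_⟩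
    change (resC d1 d2 h).d 1 0 ≫ ModuleCat.ofHom g = x
    rw [resC_d]
    exact ModuleCat.hom_ext hg
  | 2 => exact absurd rfl hp
  | n + 3 =>
    rw [HomologicalComplex.exactAt_iff]
    refine ShortComplex.exact_of_isZero_X₂ _ ?_
    have : Subsingleton (ModuleCat.of R PUnit ⟶ ModuleCat.of R R) :=
      ⟨fun f g => ModuleCat.hom_ext (LinearMap.ext fun x => by
        rw [Subsingleton.elim x 0, map_zero, map_zero])⟩
    exact ModuleCat.isZero_of_subsingleton (ModuleCat.of R (ModuleCat.of R PUnit ⟶ ModuleCat.of R R))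

/-- homs out of `R²` -/
noncomputable def homEquiv2 (R : Type) [CommRing R] :
    (ModuleCat.of R (Fin 2 → R) ⟶ ModuleCat.of R R) ≃ₗ[R] (Fin 2 → R) :=
  ModuleCat.homLinearEquiv (S := R) ≪≫ₗ (LinearEquiv.piRing R R (Fin 2) R)

theorem ext_two (h : d1.comp d2 = 0) (I : Ideal R) (hI : LinearMap.range d1 = I)
    (h1 : LinearMap.range d2 = LinearMap.ker d1) (h2 : Function.Injective d2)
    (N : Submodule R (Fin 2 → R))
    (hN : ∀ y, y ∈ N ↔ ∃ g : (Fin 3 → R) →ₗ[R] R, ∀ i, g (d2 (Pi.single i 1)) = y i) :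
    Nonempty ((((Ext R (ModuleCat R) 2).obj
      (op (ModuleCat.of R (R ⧸ I)))).obj (ModuleCat.of R R)) ≃ₗ[R] ((Fin 2 → R) ⧸ N)) := by
  let e := (theRes d1 d2 h I hI h1 h2).isoExt (R := R) 2 (ModuleCat.of R R)
  let K := (resC d1 d2 h).linearYonedaObj R (ModuleCat.of R R)
  let e2 : K.homology 2 ≅ (K.sc' 1 2 3).homology := K.homologyIsoSc' 1 2 3 (by simp) (by simp)
  have hg : (K.sc' 1 2 3).g = 0 := by
    ext x
    change (resC d1 d2 h).d 3 2 ≫ (x : ModuleCat.of R (Fin 2 → R) ⟶ ModuleCat.of R R) = 0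
    rw [resC_d]
    exact Limits.zero_comp
  let e3 := (K.sc' 1 2 3).asIsoHomologyι hg
  let e4 := (K.sc' 1 2 3).moduleCatOpcyclesIso
  let E := (e ≪≫ e2 ≪≫ e3 ≪≫ e4).toLinearEquiv
  refine ⟨E ≪≫ₗ Submodule.Quotient.equiv _ N (homEquiv2 R) ?_⟩
  ext y
  rw [hN]
  constructor
  · rintro ⟨_, ⟨g, rfl⟩, rfl⟩
    refine ⟨(show ModuleCat.of R (Fin 3 → R) ⟶ ModuleCat.of R R from g).hom, fun i => ?_⟩
    change _ = homEquiv2 R ((resC d1 d2 h).d 2 1 ≫ g) i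
    rw [resC_d]
    rfl
  · rintro ⟨g, hg⟩
    refine ⟨_, ⟨ModuleCat.ofHom g, rfl⟩, ?_⟩
    ext i
    rw [← hg]
    change homEquiv2 R ((resC d1 d2 h).d 2 1 ≫ ModuleCat.ofHom g) i = _
    rw [resC_d]
    rfl

end resolution

theorem q_irr (k : Type) [Field k] : Prime ((X 2 : PolyS k) ^ 2 - X 0 * X 1) := by
  classical
  have h : Irreducible ((-X 1 : PolyS k) * X 0 + X 2 ^ 2) := by
    apply irreducible_mul_X_add
    · simp
    · simp [MvPolynomial.vars_neg, MvPolynomial.vars_X]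
    · intro h
      have := MvPolynomial.vars_pow _ _ h
      simp [MvPolynomial.vars_X] at this
    · have h1 : Prime (X 1 : PolyS k) := by
        have := irreducible_mul_X_add (1 : PolyS k) 0 1 one_ne_zero (by simp) (by simp)
          isRelPrime_one_left
        rw [one_mul, add_zero] at this
        exact this.prime
      apply IsRelPrime.neg_left
      rw [h1.irreducible.isRelPrime_iff_not_dvd]
      intro h
      have := h1.dvd_of_dvd_pow h
      rw [MvPolynomial.X_dvd_X] at this
      simp at this
  have := h.prime
  convert this using 1
  ring

theorem q_ndvd (k : Type) [Field k] :
    ¬ ((X 2 : PolyS k) ^ 2 - X 0 * X 1) ∣ (X 1 ^ 2 - X 2 * X 0) := by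
  intro ⟨c, hc⟩
  have := congrArg (MvPolynomial.eval ![0, 1, 0]) hc
  simp at this

theorem q_cancel (k : Type) [Field k] (x : PolyS k)
    (h : ((X 2 : PolyS k) ^ 2 - X 0 * X 1) ∣ (X 1 ^ 2 - X 2 * X 0) * x) :
    ((X 2 : PolyS k) ^ 2 - X 0 * X 1) ∣ x :=
  ((q_irr k).dvd_or_dvd h).resolve_left (q_ndvd k)

/-- exactness at `S³` of the resolution -/
theorem exact_mid (k : Type) [Field k] (r0 r1 r2 : PolyS k)
    (h : (X 1 ^ 2 - X 2 * X 0) * r0 + (X 0 ^ 2 - X 1 * X 2) * r1 + (X 2 ^ 2 - X 0 * X 1) * r2 = 0) :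
    ∃ a b : PolyS k, X 2 * a + X 0 * b = r0 ∧ X 1 * a + X 2 * b = r1 ∧ X 0 * a + X 1 * b = r2 := by
  have hq := (q_irr k).ne_zero
  obtain ⟨a, ha⟩ := q_cancel k (X 2 * r0 - X 0 * r1)
    ⟨-(X 2 * r2) + X 1 * r1, by linear_combination X 2 * h⟩
  obtain ⟨b, hb⟩ := q_cancel k (X 2 * r1 - X 1 * r0)
    ⟨X 1 * r2 - X 0 * r1, by linear_combination -X 1 * h⟩
  refine ⟨a, b, ?_, ?_, ?_⟩ <;> apply mul_left_cancel₀ hq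
  · linear_combination -X 2 * ha - X 0 * hb
  · linear_combination -X 1 * ha - X 2 * hb
  · linear_combination -X 0 * ha - X 1 * hb - h

theorem inj_left (k : Type) [Field k] (a b : PolyS k) (h0 : X 2 * a + X 0 * b = 0)
    (h1 : X 1 * a + X 2 * b = 0) : a = 0 ∧ b = 0 := by
  have hq := (q_irr k).ne_zero
  constructor <;> apply mul_left_cancel₀ hq
  · linear_combination X 2 * h0 - X 0 * h1
  · linear_combination X 2 * h1 - X 1 * h0

theorem exact_dual (k : Type) [Field k] (r0 r1 r2 : PolyS k)
    (h0 : X 2 * r0 + X 1 * r1 + X 0 * r2 = 0) (h1 : X 0 * r0 + X 2 * r1 + X 1 * r2 = 0) :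
    ∃ s : PolyS k, r0 = (X 1 ^ 2 - X 2 * X 0) * s ∧ r1 = (X 0 ^ 2 - X 1 * X 2) * s ∧
      r2 = (X 2 ^ 2 - X 0 * X 1) * s := by
  have hq := (q_irr k).ne_zero
  obtain ⟨s, hs⟩ := q_cancel k r2 ⟨r0, by linear_combination X 1 * h1 - X 2 * h0⟩
  refine ⟨s, ?_, ?_, hs⟩ <;> apply mul_left_cancel₀ hq
  · linear_combination X 2 * h0 - X 1 * h1 + (X 1 ^ 2 - X 2 * X 0) * hs
  · linear_combination X 2 * h1 - X 0 * h0 + (X 0 ^ 2 - X 1 * X 2) * hs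

theorem not_cyclic (k : Type) [Field k]
    (Mt : (Fin 3 → PolyS k) →ₗ[PolyS k] (Fin 2 → PolyS k))
    (hMt : ∀ r, Mt r = ![(X 2 : PolyS k) * r 0 + X 1 * r 1 + X 0 * r 2,
      (X 0 : PolyS k) * r 0 + X 2 * r 1 + X 1 * r 2])
    (q : (Fin 2 → PolyS k) ⧸ LinearMap.range Mt) : Submodule.span (PolyS k) {q} ≠ ⊤ := by
  intro h
  obtain ⟨w, rfl⟩ := Submodule.Quotient.mk_surjective _ q
  have key : ∀ y : Fin 2 → PolyS k, ∃ s : k, ∀ i, constantCoeff (y i) = s * constantCoeff (w i) := by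
    intro y
    have hy : Submodule.Quotient.mk y ∈ Submodule.span (PolyS k)
      {(Submodule.Quotient.mk w : (Fin 2 → PolyS k) ⧸ LinearMap.range Mt)} := h ▸ Submodule.mem_top
    obtain ⟨s, hs⟩ := Submodule.mem_span_singleton.1 hy
    rw [← Submodule.Quotient.mk_smul, Submodule.Quotient.eq] at hs
    obtain ⟨r, hr⟩ := hs
    rw [hMt] at hr
    refine ⟨constantCoeff s, fun i => ?_⟩
    have := congrArg constantCoeff (congrFun hr i)
    fin_cases i <;> simp at this ⊢ <;> linear_combination this
  obtain ⟨s, hs⟩ := key ![1, 0]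
  obtain ⟨s', hs'⟩ := key ![0, 1]
  have a0 := hs 0
  have a1 := hs 1
  have b0 := hs' 0
  have b1 := hs' 1
  simp at a0 a1 b0 b1
  grind

theorem range_eq (k : Type) [Field k]
    (Mt : (Fin 3 → PolyS k) →ₗ[PolyS k] (Fin 2 → PolyS k))
    (hMt : ∀ r, Mt r = ![(X 2 : PolyS k) * r 0 + X 1 * r 1 + X 0 * r 2,
      (X 0 : PolyS k) * r 0 + X 2 * r 1 + X 1 * r 2]) :
    LinearMap.range Mt = Submodule.span (PolyS k)
      {![(X 2 : PolyS k), X 0], ![(X 1 : PolyS k), X 2], ![(X 0 : PolyS k), X 1]} := by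
  ext y
  rw [Submodule.mem_span_triple]
  constructor
  · rintro ⟨r, rfl⟩
    refine ⟨r 0, r 1, r 2, ?_⟩
    rw [hMt]
    ext i
    fin_cases i <;> simp <;> ring_nf
  · rintro ⟨a, b, c, rfl⟩
    refine ⟨![a, b, c], ?_⟩
    rw [hMt]
    ext i
    fin_cases i <;> simp <;> ring_nf

/-- the differential `S³ → S` given by the three minors -/
noncomputable def dOne (k : Type) [Field k] : (Fin 3 → PolyS k) →ₗ[PolyS k] PolyS k :=
  Fintype.linearCombination (PolyS k)
    ![(X 1 ^ 2 - X 2 * X 0 : PolyS k), X 0 ^ 2 - X 1 * X 2, X 2 ^ 2 - X 0 * X 1]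

/-- the differential `S² → S³` -/
noncomputable def dTwo (k : Type) [Field k] : (Fin 2 → PolyS k) →ₗ[PolyS k] (Fin 3 → PolyS k) :=
  Fintype.linearCombination (PolyS k) ![![(X 2 : PolyS k), X 1, X 0], ![(X 0 : PolyS k), X 2, X 1]]

theorem dOne_apply (k : Type) [Field k] (r : Fin 3 → PolyS k) :
    dOne k r = (X 1 ^ 2 - X 2 * X 0) * r 0 + (X 0 ^ 2 - X 1 * X 2) * r 1
      + (X 2 ^ 2 - X 0 * X 1) * r 2 := by
  simp [dOne, Fintype.linearCombination_apply, Fin.sum_univ_three, mul_comm]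

theorem dTwo_apply (k : Type) [Field k] (r : Fin 2 → PolyS k) :
    dTwo k r = ![X 2 * r 0 + X 0 * r 1, X 1 * r 0 + X 2 * r 1, X 0 * r 0 + X 1 * r 1] := by
  ext1 i
  fin_cases i <;>
    simp [dTwo, Fintype.linearCombination_apply, Fin.sum_univ_two, mul_comm]

theorem dOne_range (k : Type) [Field k] : LinearMap.range (dOne k) = triplePointIdeal k := by
  apply le_antisymm
  · rintro _ ⟨r, rfl⟩
    rw [dOne_apply]
    have a : (X 0 * X 1 - X 2 ^ 2 : PolyS k) ∈ triplePointIdeal k := Ideal.subset_span (by simp)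
    have b : (X 0 * X 2 - X 1 ^ 2 : PolyS k) ∈ triplePointIdeal k := Ideal.subset_span (by simp)
    have c : (X 1 * X 2 - X 0 ^ 2 : PolyS k) ∈ triplePointIdeal k := Ideal.subset_span (by simp)
    have := add_mem (add_mem (Ideal.mul_mem_left _ (-r 0) b) (Ideal.mul_mem_left _ (-r 1) c))
      (Ideal.mul_mem_left _ (-r 2) a)
    convert this using 1
    ring
  · refine Ideal.span_le.2 ?_
    rintro x (rfl | rfl | rfl)
    · refine ⟨![0, 0, -1], ?_⟩
      rw [dOne_apply]; simp
    · refine ⟨![-1, 0, 0], ?_⟩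
      rw [dOne_apply]; simp; ring
    · refine ⟨![0, -1, 0], ?_⟩
      rw [dOne_apply]; simp

theorem d_comp (k : Type) [Field k] : (dOne k).comp (dTwo k) = 0 := by
  refine LinearMap.ext fun r => ?_
  rw [LinearMap.comp_apply, dOne_apply, dTwo_apply]
  simp
  ring

theorem d_exact (k : Type) [Field k] : LinearMap.range (dTwo k) = LinearMap.ker (dOne k) := by
  apply le_antisymm
  · rw [LinearMap.range_le_ker_iff]
    exact d_comp k
  · intro r hr
    rw [LinearMap.mem_ker, dOne_apply] at hr
    obtain ⟨a, b, h0, h1, h2⟩ := exact_mid k _ _ _ hr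
    refine ⟨![a, b], ?_⟩
    rw [dTwo_apply]
    ext1 i
    fin_cases i
    · exact h0
    · exact h1
    · exact h2

theorem dTwo_inj (k : Type) [Field k] : Function.Injective (dTwo k) := by
  rw [injective_iff_map_eq_zero]
  intro r hr
  rw [dTwo_apply] at hr
  obtain ⟨a, b⟩ := inj_left k _ _ (congrFun hr 0) (congrFun hr 1)
  ext1 i
  fin_cases i
  · exact a
  · exact b

theorem dual_zero (k : Type) [Field k] (f : PolyS k →ₗ[PolyS k] PolyS k)
    (hf : f.comp (dOne k) = 0) : f = 0 := by
  have hq := (q_irr k).ne_zero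
  refine LinearMap.ext_ring ?_
  have := LinearMap.congr_fun hf ![0, 0, 1]
  rw [LinearMap.comp_apply, dOne_apply] at this
  apply mul_left_cancel₀ hq
  rw [← smul_eq_mul, ← map_smul]
  simpa using this

theorem dual_apply (k : Type) [Field k] (f : (Fin 3 → PolyS k) →ₗ[PolyS k] PolyS k)
    (r : Fin 3 → PolyS k) : f r = r 0 * f (Pi.single 0 1) + r 1 * f (Pi.single 1 1)
      + r 2 * f (Pi.single 2 1) := by
  rw [LinearMap.pi_apply_eq_sum_univ f r, Fin.sum_univ_three]
  simp only [smul_eq_mul]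
  have : ∀ i : Fin 3, (fun j => if i = j then (1 : PolyS k) else 0) = Pi.single i 1 := by
    intro i; ext1 j; simp [Pi.single_apply, eq_comm]
  simp only [this]

theorem dTwo_single (k : Type) [Field k] :
    dTwo k (Pi.single 0 1) = ![X 2, X 1, X 0] ∧ dTwo k (Pi.single 1 1) = ![X 0, X 2, X 1] := by
  constructor <;> rw [dTwo_apply] <;> simp

theorem dual_one (k : Type) [Field k] (f : (Fin 3 → PolyS k) →ₗ[PolyS k] PolyS k)
    (hf : f.comp (dTwo k) = 0) : ∃ g : PolyS k →ₗ[PolyS k] PolyS k, g.comp (dOne k) = f := by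
  have e0 := LinearMap.congr_fun hf (Pi.single 0 1)
  have e1 := LinearMap.congr_fun hf (Pi.single 1 1)
  rw [LinearMap.comp_apply, (dTwo_single k).1, dual_apply] at e0
  rw [LinearMap.comp_apply, (dTwo_single k).2, dual_apply] at e1
  obtain ⟨s, h0, h1, h2⟩ := exact_dual k _ _ _ e0 e1
  refine ⟨LinearMap.toSpanSingleton (PolyS k) (PolyS k) s, LinearMap.ext fun r => ?_⟩
  rw [LinearMap.comp_apply, dOne_apply, dual_apply, h0, h1, h2,
    LinearMap.toSpanSingleton_apply, smul_eq_mul]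
  ring

theorem dual_two (k : Type) [Field k]
    (Mt : (Fin 3 → PolyS k) →ₗ[PolyS k] (Fin 2 → PolyS k))
    (hMt : ∀ r, Mt r = ![(X 2 : PolyS k) * r 0 + X 1 * r 1 + X 0 * r 2,
      (X 0 : PolyS k) * r 0 + X 2 * r 1 + X 1 * r 2]) (y : Fin 2 → PolyS k) :
    y ∈ LinearMap.range Mt ↔
      ∃ g : (Fin 3 → PolyS k) →ₗ[PolyS k] PolyS k, ∀ i, g (dTwo k (Pi.single i 1)) = y i := by
  constructor
  · rintro ⟨r, rfl⟩
    refine ⟨Fintype.linearCombination (PolyS k) r, fun i => ?_⟩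
    rw [hMt]
    fin_cases i
    · change _ = X 2 * r 0 + X 1 * r 1 + X 0 * r 2
      change Fintype.linearCombination (PolyS k) r (dTwo k (Pi.single 0 1)) = _
      rw [(dTwo_single k).1]
      simp [Fintype.linearCombination_apply, Fin.sum_univ_three]
    · change _ = X 0 * r 0 + X 2 * r 1 + X 1 * r 2
      change Fintype.linearCombination (PolyS k) r (dTwo k (Pi.single 1 1)) = _
      rw [(dTwo_single k).2]
      simp [Fintype.linearCombination_apply, Fin.sum_univ_three]
  · rintro ⟨g, hg⟩
    refine ⟨fun i => g (Pi.single i 1), ?_⟩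
    rw [hMt]
    ext1 i
    rw [← hg]
    fin_cases i
    · change _ = g (dTwo k (Pi.single 0 1))
      rw [(dTwo_single k).1, dual_apply k g ![_, _, _]]; rfl
    · change _ = g (dTwo k (Pi.single 1 1))
      rw [(dTwo_single k).2, dual_apply k g ![_, _, _]]; rfl

/-- Let `k` be a field, `S = k[u,v,t]` and
`I = (uv - t², ut - v², vt - u²) ⊆ S`.  Let `Mᵀ : S³ → S²` be the map
`(r₁, r₂, r₃) ↦ (t r₁ + v r₂ + u r₃, u r₁ + t r₂ + v r₃)`.  Then `Ext^p_S(S/I, S) = 0` for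
`p ≠ 2`, and `Ext²_S(S/I, S)` is isomorphic as an `S`-module to the cokernel of `Mᵀ`, i.e. to
`S²` modulo the submodule generated by `(t, u)`, `(v, t)` and `(u, v)`.  Moreover this module is
nonzero and cannot be generated by a single element as an `S`-module. -/
theorem stmt13 (k : Type) [Field k]
    (Mt : (Fin 3 → PolyS k) →ₗ[PolyS k] (Fin 2 → PolyS k))
    (hMt : ∀ r, Mt r = ![(X 2 : PolyS k) * r 0 + X 1 * r 1 + X 0 * r 2,
      (X 0 : PolyS k) * r 0 + X 2 * r 1 + X 1 * r 2]) :
    -- the range of `Mᵀ` is the submodule of `S²` generated by `(t,u)`, `(v,t)`, `(u,v)`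
    LinearMap.range Mt = Submodule.span (PolyS k)
      {![(X 2 : PolyS k), X 0], ![(X 1 : PolyS k), X 2], ![(X 0 : PolyS k), X 1]} ∧
    -- `Ext^p_S(S/I, S) = 0` for `p ≠ 2`
    (∀ p : ℕ, p ≠ 2 → Subsingleton
      (((Ext (PolyS k) (ModuleCat (PolyS k)) p).obj
          (op (ModuleCat.of (PolyS k) (PolyS k ⧸ triplePointIdeal k)))).obj
        (ModuleCat.of (PolyS k) (PolyS k)))) ∧
    -- `Ext²_S(S/I, S)` is isomorphic to the cokernel of `Mᵀ`
    Nonempty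
      ((((Ext (PolyS k) (ModuleCat (PolyS k)) 2).obj
          (op (ModuleCat.of (PolyS k) (PolyS k ⧸ triplePointIdeal k)))).obj
        (ModuleCat.of (PolyS k) (PolyS k))) ≃ₗ[PolyS k]
        ((Fin 2 → PolyS k) ⧸ LinearMap.range Mt)) ∧
    -- the cokernel is nonzero
    Nontrivial ((Fin 2 → PolyS k) ⧸ LinearMap.range Mt) ∧
    -- and it is not cyclic as an `S`-module
    (∀ q : (Fin 2 → PolyS k) ⧸ LinearMap.range Mt,
      Submodule.span (PolyS k) {q} ≠ ⊤) := by
  refine ⟨range_eq k Mt hMt, fun p hp => ?_, ?_, ?_, not_cyclic k Mt hMt⟩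
  · exact ext_subsing (dOne k) (dTwo k) (d_comp k) _ (dOne_range k) (d_exact k) (dTwo_inj k)
      (dual_zero k) (dual_one k) p hp
  · exact ext_two (dOne k) (dTwo k) (d_comp k) _ (dOne_range k) (d_exact k) (dTwo_inj k) _
      (dual_two k Mt hMt)
  · by_contra h
    rw [not_nontrivial_iff_subsingleton] at h
    exact not_cyclic k Mt hMt 0 (Subsingleton.elim _ _)
end
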